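/- Let T be a cop-win tree of infinite radius. Then ρ(T) = η(T) + ω. -/

import Mathlib

universe u

open Ordinal

open Classical in
/-- The Nowakowski–Winkler relations `≤_α`: `u ≤_0 v` iff `u = v`; for `α > 0`,
`u ≤_α v` iff every `x ∈ N[u]` has some `y ∈ N[v]` with `x ≤_β y` for some `β < α`. -/
noncomputable def crRel {V : Type u} (G : SimpleGraph V) (α : Ordinal.{u}) (a b : V) : Prop :=
  if α = 0 then a = b
  else ∀ x ∈ insert a (G.neighborSet a), ∃ y ∈ insert b (G.neighborSet b),
    ∃ β : Ordinal.{u}, ∃ _ : β < α, crRel G β x y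
termination_by α
decreasing_by assumption

/-- The CR-ordinal `ρ(G)`: the least ordinal where the tower `≤_α` stabilizes. -/
noncomputable def CRord {V : Type u} (G : SimpleGraph V) : Ordinal.{u} :=
  sInf {ρ : Ordinal.{u} | crRel G ρ = crRel G (ρ + 1)}

/-- `G` is cop-win when the stabilized relation is trivial. -/
def CopWin {V : Type u} (G : SimpleGraph V) : Prop :=
  ∀ a b : V, crRel G (CRord G) a b

/-- `η(u, v)`: least `α` with `u ≤_α v`. -/
noncomputable def etaPair {V : Type u} (G : SimpleGraph V) (a b : V) : Ordinal.{u} :=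
  sInf {α : Ordinal.{u} | crRel G α a b}

/-- `η(v) = sup_u η(u, v)`. -/
noncomputable def etaVert {V : Type u} (G : SimpleGraph V) (b : V) : Ordinal.{u} :=
  ⨆ a : V, etaPair G a b

/-- `η(G) = min_v η(v)`. -/
noncomputable def etaG {V : Type u} (G : SimpleGraph V) : Ordinal.{u} :=
  ⨅ b : V, etaVert G b

/-- `θ(G)`: the vertices realizing `η(G)`. -/
def theta {V : Type u} (G : SimpleGraph V) : Set V :=
  {b | etaVert G b = etaG G}

/-- Eccentricity of a vertex, as an extended natural number. -/
noncomputable def ecc {V : Type u} (G : SimpleGraph V) (v : V) : ℕ∞ :=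
  ⨆ u : V, G.edist v u

/-- Radius: minimum eccentricity. -/
noncomputable def radius {V : Type u} (G : SimpleGraph V) : ℕ∞ :=
  ⨅ v : V, ecc G v

/-- Diameter: supremum of distances. -/
noncomputable def diam {V : Type u} (G : SimpleGraph V) : ℕ∞ :=
  ⨆ u : V, ⨆ v : V, G.edist u v

/-! ### Basic properties of the relations `≤_α` -/

theorem crRel_zero {V : Type u} {G : SimpleGraph V} {a b : V} : crRel G 0 a b ↔ a = b := by
  rw [crRel, if_pos rfl]

theorem crRel_iff_of_ne_zero {V : Type u} {G : SimpleGraph V} {α : Ordinal.{u}} (hα : α ≠ 0)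
    {a b : V} :
    crRel G α a b ↔ ∀ x ∈ insert a (G.neighborSet a), ∃ y ∈ insert b (G.neighborSet b),
      ∃ β < α, crRel G β x y := by
  rw [crRel, if_neg hα]
  simp only [exists_prop]

theorem crRel_mono {V : Type u} {G : SimpleGraph V} {α β : Ordinal.{u}} (h : α ≤ β) {a b : V}
    (hab : crRel G α a b) : crRel G β a b := by
  obtain rfl | hβ := eq_or_ne β 0
  · rwa [nonpos_iff_eq_zero.1 h] at hab
  rw [crRel_iff_of_ne_zero hβ]
  obtain rfl | hα := eq_or_ne α 0
  · obtain rfl := crRel_zero.1 hab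
    exact fun x hx => ⟨x, hx, 0, pos_iff_ne_zero.2 hβ, crRel_zero.2 rfl⟩
  · rw [crRel_iff_of_ne_zero hα] at hab
    intro x hx
    obtain ⟨y, hy, γ, hγ, hxy⟩ := hab x hx
    exact ⟨y, hy, γ, hγ.trans_le h, hxy⟩

/-- The cop may spend one move on going to a neighbour. -/
theorem crRel_add_one_of_adj {V : Type u} {G : SimpleGraph V} {α : Ordinal.{u}} {v w : V}
    (hvw : G.Adj v w) (h : ∀ u, crRel G α u w) (u : V) : crRel G (α + 1) u v := by
  rw [crRel_iff_of_ne_zero (by simp)]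
  exact fun x _ => ⟨w, Or.inr hvw, α, lt_add_one α, h x⟩

/-! ### Distances in trees -/

namespace SimpleGraph

theorem Connected.exists_adj_dist_eq {V : Type u} {G : SimpleGraph V} (hG : G.Connected)
    {w c : V} {n : ℕ} (h : G.dist w c = n + 1) : ∃ x, G.Adj c x ∧ G.dist w x = n := by
  obtain ⟨p, hp⟩ := hG.exists_walk_length_eq_dist c w
  rw [dist_comm, h] at hp
  cases p with
  | nil => simp at hp
  | @cons _ x _ hcx q =>
    refine ⟨x, hcx, ?_⟩
    have h1 : G.dist x w ≤ q.length := dist_le q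
    have h2 := hcx.diff_dist_adj (u := w)
    rw [Walk.length_cons] at hp
    rw [dist_comm] at h1
    omega

/-- In a tree, at most one neighbour of `c` is closer than `c` to a given vertex. -/
theorem IsTree.eq_of_adj_of_dist_lt {V : Type u} {T : SimpleGraph V} (hT : T.IsTree)
    {w c a b : V} (ha : T.Adj c a) (hb : T.Adj c b) (hwa : T.dist w a < T.dist w c)
    (hwb : T.dist w b < T.dist w c) : a = b := by
  obtain ⟨p, hp⟩ := hT.connected.exists_walk_length_eq_dist a w
  obtain ⟨q, hq⟩ := hT.connected.exists_walk_length_eq_dist b w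
  rw [dist_comm] at hp hq
  have h1 : (Walk.cons ha p).IsPath := by
    apply Walk.isPath_of_length_eq_dist
    have := ha.diff_dist_adj (u := w)
    rw [Walk.length_cons, dist_comm]
    omega
  have h2 : (Walk.cons hb q).IsPath := by
    apply Walk.isPath_of_length_eq_dist
    have := hb.diff_dist_adj (u := w)
    rw [Walk.length_cons, dist_comm]
    omega
  have h3 := (hT.existsUnique_path c w).unique h1 h2
  injection h3

/-- The only edge of a tree between the two sides of the edge `yv` is `yv` itself. -/
theorem IsTree.eq_of_adj_of_dist_lt_of_dist_lt {V : Type u} {T : SimpleGraph V} (hT : T.IsTree)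
    {y v w w' : V} (hyv : T.Adj y v) (hww' : T.Adj w w') (hw : T.dist w v < T.dist w y)
    (hw' : T.dist w' y < T.dist w' v) : w = v := by
  have h1 := hyv.diff_dist_adj (u := w)
  have h2 := hyv.diff_dist_adj (u := w')
  have h3 := hww'.diff_dist_adj (u := v)
  have h4 := hww'.diff_dist_adj (u := y)
  simp only [T.dist_comm (u := v), T.dist_comm (u := y)] at h3 h4
  by_contra hne
  have h5 := hT.connected.pos_dist_of_ne hne
  obtain ⟨k, hk⟩ : ∃ k, T.dist y w' = k + 1 := ⟨T.dist w' y - 1, by rw [dist_comm]; omega⟩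
  obtain ⟨z, hz, hzk⟩ := hT.connected.exists_adj_dist_eq hk
  rw [dist_comm] at hk
  have h6 := hyv.diff_dist_adj (u := z)
  rw [dist_comm] at hzk
  have h7 : z = w := by
    apply hT.eq_of_adj_of_dist_lt (w := v) hz hww'.symm <;>
    simp only [T.dist_comm (u := v)] <;> omega
  subst h7
  omega

/-- After a move, a vertex beyond the edge `cy` is still beyond every other edge `cx`. -/
theorem IsTree.dist_lt_of_mem_insert_neighborSet {V : Type u} {T : SimpleGraph V}
    (hT : T.IsTree) {y c x w w' : V} (hyc : T.Adj y c) (hcx : T.Adj c x) (hxy : x ≠ y)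
    (hw : T.dist w y < T.dist w c) (hw' : w' ∈ insert w (T.neighborSet w)) :
    T.dist w' c < T.dist w' x := by
  have h1 : T.dist w c < T.dist w x := by
    refine lt_of_not_ge fun h => hxy ?_
    exact hT.eq_of_adj_of_dist_lt hcx hyc.symm (h.lt_of_ne (hT.dist_ne_of_adj w hcx.symm)) hw
  obtain rfl | hw' := hw'
  · exact h1
  refine lt_of_not_ge fun h => ?_
  have h2 := hT.eq_of_adj_of_dist_lt_of_dist_lt hcx.symm hw' h1
    (h.lt_of_ne (hT.dist_ne_of_adj w' hcx.symm))
  subst h2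
  simp at hw

end SimpleGraph

/-! ### Ranks of branches -/

/-- `(c, x)` is a child of `(y, c)` when `x` is a neighbour of `c` other than `y`. -/
def BranchChild {V : Type u} (T : SimpleGraph V) (p q : V × V) : Prop :=
  T.Adj p.1 p.2 ∧ p.1 = q.2 ∧ p.2 ≠ q.1

theorem branchChild_mk {V : Type u} {T : SimpleGraph V} {y c x : V} (hcx : T.Adj c x)
    (hxy : x ≠ y) : BranchChild T (c, x) (y, c) :=
  ⟨hcx, rfl, hxy⟩

/-- A robber at `c` can retreat into the branch at `c` away from `y`. -/
theorem exists_acc_rank_le_of_crRel {V : Type u} {T : SimpleGraph V} (hT : T.IsTree)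
    {α : Ordinal.{u}} {y c w : V} (hyc : T.Adj y c) (hw : T.dist w y < T.dist w c)
    (h : crRel T α c w) : ∃ hacc : Acc (BranchChild T) (y, c), hacc.rank ≤ α := by
  induction α using WellFoundedLT.induction generalizing y c w with
  | _ α ih =>
  have hcw : c ≠ w := by
    rintro rfl
    simp at hw
  have hα : α ≠ 0 := by
    rintro rfl
    exact hcw (crRel_zero.1 h)
  rw [crRel_iff_of_ne_zero hα] at h
  have key : ∀ p, BranchChild T p (y, c) →
      ∃ hacc : Acc (BranchChild T) p, hacc.rank < α := by
    rintro ⟨c', x⟩ ⟨hcx, hc, hxy⟩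
    dsimp only at hcx hc hxy
    subst hc
    obtain ⟨w', hw', β, hβ, hxw'⟩ := h x (Or.inr hcx)
    obtain ⟨hacc, hrank⟩ :=
      ih β hβ hcx (hT.dist_lt_of_mem_insert_neighborSet hyc hcx hxy hw hw') hxw'
    exact ⟨hacc, hrank.trans_lt hβ⟩
  refine ⟨Acc.intro _ fun p hp => (key p hp).1, ?_⟩
  rw [Acc.rank_eq]
  refine Ordinal.iSup_le fun p => Order.succ_le_of_lt ?_
  exact (key p p.2).2

theorem isWellFounded_branchChild {V : Type u} {T : SimpleGraph V} (hT : T.IsTree)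
    (hwin : CopWin T) : IsWellFounded (V × V) (BranchChild T) := by
  refine ⟨⟨fun q => Acc.intro q ?_⟩⟩
  rintro ⟨y, c⟩ ⟨hyc, -, -⟩
  have hyc' : T.Adj y c := hyc
  refine (exists_acc_rank_le_of_crRel hT hyc' (w := y) ?_ (hwin c y)).1
  rw [SimpleGraph.dist_self]
  exact hT.connected.pos_dist_of_ne hyc'.ne

/-- The rank of the branch of `T` at `c` away from `y`; for `y = c` this branch is all of `T`. -/
noncomputable def branchRank {V : Type u} (T : SimpleGraph V)
    [IsWellFounded (V × V) (BranchChild T)] (y c : V) : Ordinal.{u} :=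
  IsWellFounded.rank (BranchChild T) (y, c)

section BranchRank

variable {V : Type u} {T : SimpleGraph V} [IsWellFounded (V × V) (BranchChild T)]

theorem branchRank_lt {y c x : V} (hcx : T.Adj c x) (hxy : x ≠ y) :
    branchRank T c x < branchRank T y c :=
  IsWellFounded.rank_lt_of_rel (branchChild_mk hcx hxy)

theorem branchRank_le_iff {y c : V} {α : Ordinal.{u}} :
    branchRank T y c ≤ α ↔ ∀ x, T.Adj c x → x ≠ y → branchRank T c x < α := by
  refine ⟨fun h x hcx hxy => (branchRank_lt hcx hxy).trans_le h, fun h => ?_⟩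
  rw [branchRank, IsWellFounded.rank_eq]
  refine Ordinal.iSup_le ?_
  rintro ⟨⟨c', x⟩, hcx, hc, hxy⟩
  dsimp only at hcx hc hxy
  subst hc
  exact Order.succ_le_of_lt (h x hcx hxy)

theorem lt_branchRank_iff {y c : V} {α : Ordinal.{u}} :
    α < branchRank T y c ↔ ∃ x, T.Adj c x ∧ x ≠ y ∧ α ≤ branchRank T c x := by
  rw [← not_le, branchRank_le_iff]
  push Not
  rfl

theorem branchRank_le_of_crRel (hT : T.IsTree) {α : Ordinal.{u}} {y c w : V} (hyc : T.Adj y c)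
    (hw : T.dist w y < T.dist w c) (h : crRel T α c w) : branchRank T y c ≤ α :=
  (exists_acc_rank_le_of_crRel hT hyc hw h).2

/-- A robber at `c` can wait for the cop before retreating away from `y`. -/
theorem branchRank_add_natCast_le_of_crRel (hT : T.IsTree) {α : Ordinal.{u}} {y c w : V} {n : ℕ}
    (hyc : T.Adj y c) (hw : T.dist w y < T.dist w c) (hn : n + 1 ≤ T.dist w c)
    (h : crRel T α c w) : branchRank T y c + n ≤ α := by
  induction n generalizing w α with
  | zero => simpa using branchRank_le_of_crRel hT hyc hw h
  | succ n ih =>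
    have hα : α ≠ 0 := by
      rintro rfl
      obtain rfl := crRel_zero.1 h
      simp at hn
    rw [crRel_iff_of_ne_zero hα] at h
    obtain ⟨w', hw', β, hβ, hcw'⟩ := h c (Or.inl rfl)
    have hlt : T.dist w' y < T.dist w' c ∧ n + 1 ≤ T.dist w' c := by
      obtain rfl | hw' := hw'
      · exact ⟨hw, by omega⟩
      have hww' : T.Adj w w' := hw'
      have hdist := hww'.diff_dist_adj (u := c)
      simp only [T.dist_comm (u := c)] at hdist
      refine ⟨lt_of_not_ge fun hge => ?_, by omega⟩
      have h1 := hT.eq_of_adj_of_dist_lt_of_dist_lt hyc.symm hww' hw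
        (hge.lt_of_ne (hT.dist_ne_of_adj w' hyc.symm))
      subst h1
      rw [SimpleGraph.dist_eq_one_iff_adj.2 hyc] at hn
      omega
    have h2 := (ih hlt.1 hlt.2 hcw').trans_lt hβ
    rw [Nat.cast_add_one, ← add_assoc]
    exact Order.add_one_le_of_lt h2

/-- A cop at `v` catches a robber in the branch at `v` away from `y` by following it. -/
theorem crRel_branchRank (hT : T.IsTree) {y v : V} (hyv : y = v ∨ T.Adj y v) {u : V}
    (hu : T.dist u v ≤ T.dist u y) : crRel T (branchRank T y v) u v := by
  suffices H : ∀ p : V × V, (p.1 = p.2 ∨ T.Adj p.1 p.2) → ∀ u,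
      T.dist u p.2 ≤ T.dist u p.1 → crRel T (branchRank T p.1 p.2) u p.2 from H (y, v) hyv u hu
  intro p
  induction p using IsWellFounded.induction (BranchChild T) with
  | _ p ih =>
  obtain ⟨y, v⟩ := p
  intro hyv u hu
  dsimp only at hyv hu ⊢
  have step : ∀ x, x ≠ v → T.dist x v ≤ T.dist x y →
      ∃ v', T.Adj v v' ∧ T.dist x v' < T.dist x v ∧ v' ≠ y := by
    intro x hxv hx
    obtain ⟨n, hn⟩ := Nat.exists_eq_add_of_lt (hT.connected.pos_dist_of_ne hxv)
    rw [Nat.zero_add] at hn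
    obtain ⟨v', hv', hd⟩ := hT.connected.exists_adj_dist_eq hn
    refine ⟨v', hv', by omega, ?_⟩
    rintro rfl
    omega
  obtain rfl | huv := eq_or_ne u v
  · exact crRel_mono zero_le (crRel_zero.2 rfl)
  obtain ⟨z, hz, -, hzy⟩ := step u huv hu
  have hpos : 0 < branchRank T y v := zero_le.trans_lt (branchRank_lt hz hzy)
  rw [crRel_iff_of_ne_zero hpos.ne']
  intro x hx
  obtain rfl | hxv := eq_or_ne x v
  · exact ⟨x, Or.inl rfl, 0, hpos, crRel_zero.2 rfl⟩
  have hxy : T.dist x v ≤ T.dist x y := by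
    obtain rfl | hx := hx
    · exact hu
    obtain rfl | hyv := hyv
    · exact le_rfl
    refine le_of_not_gt fun hlt => huv ?_
    exact hT.eq_of_adj_of_dist_lt_of_dist_lt hyv hx
      (hu.lt_of_ne (hT.dist_ne_of_adj u hyv.symm)) hlt
  obtain ⟨v', hv', hd, hv'y⟩ := step x hxv hxy
  exact ⟨v', Or.inr hv', _, branchRank_lt hv' hv'y,
    ih (v, v') (branchChild_mk hv' hv'y) (Or.inr hv') x hd.le⟩

theorem natCast_dist_le_branchRank (hT : T.IsTree) {y c w : V} (hw : T.dist w c ≤ T.dist w y) :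
    (T.dist w c : Ordinal.{u}) ≤ branchRank T y c := by
  induction hn : T.dist w c generalizing y c with
  | zero => simp
  | succ n ih =>
    obtain ⟨x, hx, hxn⟩ := hT.connected.exists_adj_dist_eq hn
    have h1 := ih (y := c) (c := x) (by omega) hxn
    have hxy : x ≠ y := by
      rintro rfl
      omega
    rw [Nat.cast_add_one]
    exact Order.add_one_le_of_lt (h1.trans_lt (branchRank_lt hx hxy))

theorem exists_dist_eq_of_natCast_le_branchRank (hT : T.IsTree) {y c : V} (hyc : T.Adj y c)
    {n : ℕ} (hn : (n : Ordinal.{u}) ≤ branchRank T y c) :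
    ∃ w, T.dist w c = n ∧ T.dist w c < T.dist w y := by
  induction n generalizing y c with
  | zero =>
    refine ⟨c, SimpleGraph.dist_self, ?_⟩
    rw [SimpleGraph.dist_self]
    exact hT.connected.pos_dist_of_ne hyc.ne'
  | succ n ih =>
    rw [Nat.cast_add_one, Order.add_one_le_iff, lt_branchRank_iff] at hn
    obtain ⟨x, hx, hxy, hn⟩ := hn
    obtain ⟨w, hw, hlt⟩ := ih hx hn
    refine ⟨w, ?_, lt_of_not_ge fun h => hxy ?_⟩
    · have := hx.diff_dist_adj (u := w)
      omega
    · exact hT.eq_of_adj_of_dist_lt hx hyc.symm hlt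
        (h.lt_of_ne (hT.dist_ne_of_adj w hyc))

/-- A cop approaching `c` through an unbounded branch can be kept waiting arbitrarily long. -/
theorem branchRank_add_omega0_le_crOrd (hT : T.IsTree) (hwin : CopWin T) {y c : V}
    (hyc : T.Adj y c) (h : ω ≤ branchRank T c y) : branchRank T y c + ω ≤ CRord T := by
  rw [Ordinal.add_le_iff_of_isSuccLimit Ordinal.isSuccLimit_omega0]
  intro γ hγ
  obtain ⟨n, rfl⟩ := Ordinal.lt_omega0.1 hγ
  obtain ⟨w, hw, hlt⟩ :=
    exists_dist_eq_of_natCast_le_branchRank hT hyc.symm (Ordinal.omega0_le.1 h n)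
  exact branchRank_add_natCast_le_of_crRel hT hyc hlt (by omega) (hwin c w)

theorem etaG_le_branchRank_self (hT : T.IsTree) (x : V) : etaG T ≤ branchRank T x x := by
  refine (ciInf_le' _ x).trans (Ordinal.iSup_le fun a => ?_)
  exact csInf_le' (crRel_branchRank hT (Or.inl rfl) le_rfl)

end BranchRank

theorem crRel_etaG_add_dist {V : Type u} {T : SimpleGraph V} (hT : T.IsTree)
    (hwin : CopWin T) : ∃ b, ∀ u v, crRel T (etaG T + (T.dist v b : Ordinal.{u})) u v := by
  have := hT.connected.nonempty
  obtain ⟨b, hb⟩ := ciInf_mem (etaVert T)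
  refine ⟨b, fun u v => ?_⟩
  induction hn : T.dist v b generalizing u v with
  | zero =>
    obtain rfl := hT.connected.dist_eq_zero_iff.1 hn
    rw [Nat.cast_zero, add_zero, etaG, ← hb]
    have h1 : crRel T (etaPair T u v) u v := csInf_mem (s := {α | crRel T α u v}) ⟨_, hwin u v⟩
    exact crRel_mono (Ordinal.le_iSup (fun a => etaPair T a v) u) h1
  | succ n ih =>
    rw [SimpleGraph.dist_comm] at hn
    obtain ⟨x, hx, hxn⟩ := hT.connected.exists_adj_dist_eq hn
    rw [Nat.cast_add_one, ← add_assoc]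
    exact crRel_add_one_of_adj hx (fun u => ih u x (by rw [SimpleGraph.dist_comm, hxn])) u

theorem crOrd_le_etaG_add_omega0 {V : Type u} {T : SimpleGraph V} (hT : T.IsTree)
    (hwin : CopWin T) : CRord T ≤ etaG T + ω := by
  obtain ⟨b, hb⟩ := crRel_etaG_add_dist hT hwin
  have h : ∀ u v, crRel T (etaG T + ω) u v := fun u v =>
    crRel_mono (by gcongr; exact (Ordinal.natCast_lt_omega0 _).le) (hb u v)
  refine csInf_le' ?_
  ext u v
  exact ⟨fun _ => crRel_mono le_self_add (h u v), fun _ => h u v⟩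

theorem exists_le_dist_of_radius_eq_top {V : Type u} {G : SimpleGraph V} (hG : G.Connected)
    (hrad : radius G = ⊤) (v : V) (n : ℕ) : ∃ w, n ≤ G.dist w v := by
  by_contra! h
  have h1 : ecc G v = ⊤ := iInf_eq_top.1 hrad v
  have h2 : ecc G v ≤ n := by
    refine iSup_le fun w => ?_
    rw [← (hG v w).coe_dist_eq_edist, SimpleGraph.dist_comm]
    exact_mod_cast (h w).le
  rw [h1] at h2
  exact absurd h2 (by simp)

theorem etaG_add_omega0_le_crOrd {V : Type u} {T : SimpleGraph V} (hT : T.IsTree)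
    (hwin : CopWin T) (hrad : radius T = ⊤) : etaG T + ω ≤ CRord T := by
  have := isWellFounded_branchChild hT hwin
  have far := exists_le_dist_of_radius_eq_top hT.connected hrad
  by_cases hA : ∃ v x, T.Adj v x ∧ ω ≤ branchRank T v x ∧ ω ≤ branchRank T x v
  · obtain ⟨v, x, hvx, h1, h2⟩ := hA
    have h3 := branchRank_add_omega0_le_crOrd hT hwin hvx h2
    have h4 := branchRank_add_omega0_le_crOrd hT hwin hvx.symm h1
    have h5 : etaG T ≤ max (branchRank T v x) (branchRank T x v + 1) := by
      refine (etaG_le_branchRank_self hT x).trans (branchRank_le_iff.2 fun z hz _ => ?_)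
      obtain rfl | hzv := eq_or_ne z v
      · exact lt_max_of_lt_right (lt_add_one _)
      · exact lt_max_of_lt_left (branchRank_lt hz hzv)
    obtain h5 | h5 := le_max_iff.1 h5
    · exact (by gcongr : etaG T + ω ≤ branchRank T v x + ω).trans h3
    · refine (by gcongr : etaG T + ω ≤ branchRank T x v + 1 + ω).trans ?_
      rwa [add_assoc, Ordinal.one_add_omega0]
  have hB : ∃ x, ∀ z, T.Adj x z → branchRank T x z < ω := by
    by_contra! hB
    let S : Set (V × V) := {p | T.Adj p.1 p.2 ∧ ω ≤ branchRank T p.1 p.2}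
    have hS : S.Nonempty := by
      obtain ⟨x⟩ := hT.connected.nonempty
      obtain ⟨z, hz⟩ := hB x
      exact ⟨(x, z), hz⟩
    obtain ⟨⟨v, x⟩, ⟨hvx, hω⟩, hmin⟩ :=
      (IsWellFounded.wf (r := BranchChild T)).has_min S hS
    obtain ⟨z, hz, hzω⟩ := hB x
    obtain rfl | hzv := eq_or_ne z v
    · exact hA ⟨z, x, hvx, hω, hzω⟩
    · exact hmin (x, z) ⟨hz, hzω⟩ (branchChild_mk hz hzv)
  obtain ⟨x, hx⟩ := hB
  have hη : etaG T ≤ ω :=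
    (etaG_le_branchRank_self hT x).trans (branchRank_le_iff.2 fun z hz _ => hx z hz)
  rw [Ordinal.add_le_iff_of_isSuccLimit Ordinal.isSuccLimit_omega0]
  intro γ hγ
  obtain ⟨n, rfl⟩ := Ordinal.lt_omega0.1 hγ
  obtain ⟨w, hw⟩ := far x (n + 1)
  obtain ⟨k, hk⟩ : ∃ k, T.dist w x = k + 1 := ⟨T.dist w x - 1, by omega⟩
  obtain ⟨z, hz, hzk⟩ := hT.connected.exists_adj_dist_eq hk
  have hzx : ω ≤ branchRank T z x := by
    obtain ⟨m, hm⟩ := Ordinal.lt_omega0.1 (hx z hz)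
    refine Ordinal.omega0_le.2 fun j => ?_
    obtain ⟨w', hw'⟩ := far x (max j (m + 2))
    have hside : T.dist w' x ≤ T.dist w' z := by
      refine le_of_not_gt fun hlt => ?_
      have h1 := natCast_dist_le_branchRank hT hlt.le
      rw [hm, Nat.cast_le] at h1
      have h2 := hz.diff_dist_adj (u := w')
      omega
    have h3 : j ≤ T.dist w' x := by omega
    exact (Nat.cast_le.2 h3).trans (natCast_dist_le_branchRank hT hside)
  have h4 : etaG T + n ≤ branchRank T z x + n := by
    gcongr
    exact hη.trans hzx
  exact h4.trans
    (branchRank_add_natCast_le_of_crRel hT hz.symm (by omega) hw (hwin x w))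

/-- For a cop-win tree of infinite radius, `ρ(T) = η(T) + ω`. -/
theorem crOrd_eq_etaG_add_omega_of_infinite_radius {V : Type u} (T : SimpleGraph V)
    (hT : T.IsTree) (hwin : CopWin T) (hrad : radius T = ⊤) :
    CRord T = etaG T + Ordinal.omega0 := by
  exact le_antisymm (crOrd_le_etaG_add_omega0 hT hwin) (etaG_add_omega0_le_crOrd hT hwin hrad)
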